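/- arXiv:2307.15446 — 8 statements merged into one kernel-verified Lean document; each statement's English description precedes it below -/
import Mathlib

section
/- Let a and b be nonnegative Lebesgue measurable functions on (0,∞) with ∫₀^∞ a(t) dt < +∞ and ∫₀^∞ b(t) dt < +∞, such that b(t) > 0 for almost every t ∈ (0,∞), and such that for almost every t₀ ∈ (0,∞) and every t₁ ∈ [0,t₀) one has (∫_{t₁}^{t₀} a(t) dt) · b(t₀) ≤ a(t₀) · (∫_{t₁}^{t₀} b(t) dt). Then there exists a concave function Φ on the interval (0, ∫₀^∞ b(t) dt] such that â(t) = Φ(b̂(t)) for every t ∈ [0,∞); that is, â ∘ b̂⁻¹ is concave on (0, ∫₀^∞ b(t) dt]. -/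
open MeasureTheory Set

/-- The reciprocal of an absolutely continuous function bounded below by a positive constant is
absolutely continuous. -/
theorem AbsolutelyContinuousOnInterval.inv_of_le {g : ℝ → ℝ} {p q c : ℝ}
    (hg : AbsolutelyContinuousOnInterval g p q) (hc : 0 < c) (hcg : ∀ x ∈ uIcc p q, c ≤ g x) :
    AbsolutelyContinuousOnInterval (fun x ↦ (g x)⁻¹) p q := by
  rw [absolutelyContinuousOnInterval_iff] at hg ⊢
  intro ε hε
  obtain ⟨δ, hδ, h⟩ := hg (c ^ 2 * ε) (by positivity)
  refine ⟨δ, hδ, fun E hE hlen ↦ ?_⟩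
  have hsum : ∑ i ∈ Finset.range E.1, dist (g (E.2 i).1)⁻¹ (g (E.2 i).2)⁻¹ ≤
      ∑ i ∈ Finset.range E.1, (c ^ 2)⁻¹ * dist (g (E.2 i).1) (g (E.2 i).2) := by
    refine Finset.sum_le_sum fun i hi ↦ ?_
    have hx := hcg _ (hE.1 i hi).1
    have hy := hcg _ (hE.1 i hi).2
    have hx0 := hc.trans_le hx
    have hy0 := hc.trans_le hy
    rw [dist_inv_inv₀ hx0.ne' hy0.ne', div_eq_inv_mul, Real.norm_of_nonneg hx0.le,
      Real.norm_of_nonneg hy0.le, sq]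
    gcongr
  calc _ ≤ _ := hsum
    _ = (c ^ 2)⁻¹ * ∑ i ∈ Finset.range E.1, dist (g (E.2 i).1) (g (E.2 i).2) := by
      rw [Finset.mul_sum]
    _ < (c ^ 2)⁻¹ * (c ^ 2 * ε) := by
      gcongr
      exact h E hE hlen
    _ = ε := by field_simp

/-- The interval integral of an almost everywhere positive function is positive. -/
theorem intervalIntegral_pos_of_ae_pos {f : ℝ → ℝ} {p q : ℝ} (hpq : p < q)
    (hf : IntegrableOn f (Ioc p q)) (hpos : ∀ᵐ t ∂volume.restrict (Ioc p q), 0 < f t) :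
    0 < ∫ t in p..q, f t := by
  rw [intervalIntegral.integral_of_le hpq.le]
  have hnonneg : 0 ≤ᵐ[volume.restrict (Ioc p q)] f := hpos.mono fun t ht ↦ ht.le
  refine (integral_nonneg_of_ae hnonneg).lt_of_ne' fun h0 ↦ ?_
  have hzero := (integral_eq_zero_iff_of_nonneg_ae hnonneg hf).1 h0
  have hfalse : ∀ᵐ _ ∂volume.restrict (Ioc p q), False := by
    filter_upwards [hpos, hzero] with t ht ht0 using ht.ne' ht0
  rw [Filter.eventually_false_iff_eq_bot, ae_eq_bot, Measure.restrict_eq_zero] at hfalse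
  simp [hpq.not_ge] at hfalse

/-- If the derivative of `(∫ a) / (∫ b)` is almost everywhere nonnegative, then this quotient of
integrals with a fixed left end is monotone in the right end. -/
theorem integral_mul_integral_le {a b : ℝ → ℝ} {t₁ t₂ t₃ : ℝ} (h₁₂ : t₁ < t₂) (h₂₃ : t₂ < t₃)
    (ha : IntegrableOn a (Ioc t₁ t₃)) (hb : IntegrableOn b (Ioc t₁ t₃))
    (hpos : ∀ᵐ t ∂volume.restrict (Ioc t₁ t₃), 0 < b t)
    (hineq : ∀ᵐ t ∂volume.restrict (Ioc t₁ t₃),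
      (∫ s in t₁..t, a s) * b t ≤ a t * ∫ s in t₁..t, b s) :
    (∫ s in t₁..t₂, a s) * (∫ s in t₁..t₃, b s) ≤
      (∫ s in t₁..t₃, a s) * ∫ s in t₁..t₂, b s := by
  have h₁₃ := h₁₂.trans h₂₃
  set F : ℝ → ℝ := fun x ↦ ∫ s in t₁..x, a s
  set G : ℝ → ℝ := fun x ↦ ∫ s in t₁..x, b s
  have hai : IntervalIntegrable a volume t₁ t₃ :=
    (intervalIntegrable_iff_integrableOn_Ioc_of_le h₁₃.le).2 ha
  have hbi : IntervalIntegrable b volume t₁ t₃ :=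
    (intervalIntegrable_iff_integrableOn_Ioc_of_le h₁₃.le).2 hb
  have hsub : uIcc t₂ t₃ ⊆ uIcc t₁ t₃ := uIcc_subset_uIcc_right (by
    simp [uIcc_of_le h₁₃.le, h₁₂.le, h₂₃.le])
  have hGpos : ∀ x ∈ Icc t₂ t₃, 0 < G x := fun x hx ↦ by
    have hs : Ioc t₁ x ⊆ Ioc t₁ t₃ := Ioc_subset_Ioc_right hx.2
    exact intervalIntegral_pos_of_ae_pos (h₁₂.trans_le hx.1) (hb.mono_set hs)
      (ae_restrict_of_ae_restrict_of_subset hs hpos)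
  have hFac : AbsolutelyContinuousOnInterval F t₂ t₃ :=
    (hai.absolutelyContinuousOnInterval_intervalIntegral left_mem_uIcc).mono hsub
  have hGac : AbsolutelyContinuousOnInterval G t₂ t₃ :=
    (hbi.absolutelyContinuousOnInterval_intervalIntegral left_mem_uIcc).mono hsub
  obtain ⟨m, hm, hmin⟩ := isCompact_uIcc.exists_isMinOn nonempty_uIcc hGac.continuousOn
  rw [uIcc_of_le h₂₃.le] at hm
  have hGinv := hGac.inv_of_le (hGpos m hm) fun x hx ↦ hmin hx
  have hint := (hFac.fun_mul hGinv).integral_deriv_eq_sub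
  have hderiv : 0 ≤ ∫ x in t₂..t₃, deriv (fun x ↦ F x * (G x)⁻¹) x := by
    refine intervalIntegral.integral_nonneg_of_ae_restrict h₂₃.le ?_
    rw [Filter.EventuallyLE, ae_restrict_iff' measurableSet_Icc]
    rw [ae_restrict_iff' measurableSet_Ioc] at hineq
    filter_upwards [hai.ae_hasDerivAt_integral, hbi.ae_hasDerivAt_integral, hineq]
      with x hax hbx hx hmem
    have hmem' : x ∈ uIcc t₁ t₃ := hsub (by rwa [uIcc_of_le h₂₃.le])
    have hdF : HasDerivAt F (a x) x := hax hmem' t₁ left_mem_uIcc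
    have hdG : HasDerivAt G (b x) x := hbx hmem' t₁ left_mem_uIcc
    have hGx := hGpos x hmem
    have hx' : F x * b x ≤ a x * G x := hx ⟨h₁₂.trans_le hmem.1, hmem.2⟩
    rw [(hdF.fun_mul (hdG.fun_inv hGx.ne')).deriv]
    have : a x * (G x)⁻¹ + F x * (-b x / G x ^ 2) = (a x * G x - F x * b x) / G x ^ 2 := by
      field_simp
      ring
    rw [Pi.zero_apply, this]
    exact div_nonneg (sub_nonneg.2 hx') (sq_nonneg _)
  rw [hint, sub_nonneg, ← div_eq_mul_inv, ← div_eq_mul_inv,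
    div_le_div_iff₀ (hGpos t₂ ⟨le_rfl, h₂₃.le⟩) (hGpos t₃ ⟨h₂₃.le, le_rfl⟩)] at hderiv
  exact hderiv

/-- The tail integrals of an integrable function take every value between zero and the integral
over the whole half-line. -/
theorem exists_integral_Ioi_eq {b : ℝ → ℝ} {p y : ℝ} (hb : IntegrableOn b (Ioi p))
    (hy : y ∈ Ioc 0 (∫ t in Ioi p, b t)) : ∃ t ∈ Ici p, ∫ s in Ioi t, b s = y := by
  have hlim := intervalIntegral_tendsto_integral_Ioi p hb Filter.tendsto_id
  obtain ⟨T, hT, hpT⟩ := ((hlim.eventually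
    (lt_mem_nhds (sub_lt_self _ hy.1))).and (Filter.eventually_ge_atTop p)).exists
  have hadd := intervalIntegral.integral_Ioi_sub_Ioi hb hpT
  have hcont : ContinuousOn (fun t ↦ ∫ s in Ioi t, b s) (Icc p T) :=
    hb.continuousOn_Ici_primitive_Ioi.mono Icc_subset_Ici_self
  obtain ⟨t, ht, hty⟩ := intermediate_value_Icc' hpT hcont
    ⟨by simp only [id] at hT; linarith, hy.2⟩
  exact ⟨t, ht.1, hty⟩

/-- Lemma `l:concave`: if nonnegative integrable `a, b` on `(0,∞)` with `b > 0` a.e.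
satisfy `(∫_{t₁}^{t₀} a) · b(t₀) ≤ a(t₀) · (∫_{t₁}^{t₀} b)` for a.e. `t₀` and all
`t₁ ∈ [0,t₀)`, then `â ∘ b̂⁻¹` is concave on `(0, ∫₀^∞ b]`, i.e. there is a concave
function `Φ` on that interval with `â(t) = Φ(b̂(t))` for all `t ≥ 0`. -/
theorem stmt_0 (a b : ℝ → ℝ)
    (ha_meas : Measurable a) (hb_meas : Measurable b)
    (ha_nonneg : ∀ t ∈ Ioi (0 : ℝ), 0 ≤ a t)
    (hb_nonneg : ∀ t ∈ Ioi (0 : ℝ), 0 ≤ b t)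
    (ha_int : IntegrableOn a (Ioi 0))
    (hb_int : IntegrableOn b (Ioi 0))
    (hb_pos : ∀ᵐ t ∂(volume.restrict (Ioi (0 : ℝ))), 0 < b t)
    (hineq : ∀ᵐ t₀ ∂(volume.restrict (Ioi (0 : ℝ))), ∀ t₁ ∈ Ico (0 : ℝ) t₀,
      (∫ t in Ioo t₁ t₀, a t) * b t₀ ≤ a t₀ * ∫ t in Ioo t₁ t₀, b t) :
    ∃ Φ : ℝ → ℝ, ConcaveOn ℝ (Ioc (0 : ℝ) (∫ t in Ioi (0 : ℝ), b t)) Φ ∧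
      ∀ t ∈ Ici (0 : ℝ), (∫ s in Ioi t, a s) = Φ (∫ s in Ioi t, b s) := by
  set A : ℝ → ℝ := fun t ↦ ∫ s in Ioi t, a s
  set B : ℝ → ℝ := fun t ↦ ∫ s in Ioi t, b s
  have hAsub : ∀ {s t : ℝ}, 0 ≤ s → s ≤ t → A s - A t = ∫ x in s..t, a x := fun hs hst ↦
    intervalIntegral.integral_Ioi_sub_Ioi (ha_int.mono_set (Ioi_subset_Ioi hs)) hst
  have hBsub : ∀ {s t : ℝ}, 0 ≤ s → s ≤ t → B s - B t = ∫ x in s..t, b x := fun hs hst ↦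
    intervalIntegral.integral_Ioi_sub_Ioi (hb_int.mono_set (Ioi_subset_Ioi hs)) hst
  have hIoc : ∀ {s t : ℝ}, 0 ≤ s → Ioc s t ⊆ Ioi 0 := fun hs x hx ↦ hs.trans_lt hx.1
  have hBanti : StrictAntiOn B (Ici 0) := fun s hs t _ hst ↦ by
    rw [← sub_pos, hBsub hs hst.le]
    exact intervalIntegral_pos_of_ae_pos hst (hb_int.mono_set (hIoc hs))
      (ae_restrict_of_ae_restrict_of_subset (hIoc hs) hb_pos)
  have hinv : ∀ t ∈ Ici (0 : ℝ), Function.invFunOn B (Ici 0) (B t) = t := fun t ht ↦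
    hBanti.injOn.leftInvOn_invFunOn ht
  refine ⟨fun y ↦ A (Function.invFunOn B (Ici 0) y), ?_, fun t ht ↦ (congrArg A (hinv t ht)).symm⟩
  refine concaveOn_of_slope_anti_adjacent (convex_Ioc _ _) fun {x y z} hx hz hxy hyz ↦ ?_
  obtain ⟨t₃, ht₃, rfl⟩ := exists_integral_Ioi_eq hb_int hx
  obtain ⟨t₂, ht₂, rfl⟩ := exists_integral_Ioi_eq hb_int ⟨hx.1.trans hxy, hyz.le.trans hz.2⟩
  obtain ⟨t₁, ht₁, rfl⟩ := exists_integral_Ioi_eq hb_int hz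
  change (A (Function.invFunOn B (Ici 0) (B t₁)) - A (Function.invFunOn B (Ici 0) (B t₂))) /
    (B t₁ - B t₂) ≤ (A (Function.invFunOn B (Ici 0) (B t₂)) -
      A (Function.invFunOn B (Ici 0) (B t₃))) / (B t₂ - B t₃)
  have h₁₂ : t₁ < t₂ := (hBanti.lt_iff_gt ht₂ ht₁).1 hyz
  have h₂₃ : t₂ < t₃ := (hBanti.lt_iff_gt ht₃ ht₂).1 hxy
  have hsub : Ioc t₁ t₃ ⊆ Ioi 0 := hIoc ht₁
  have key := integral_mul_integral_le h₁₂ h₂₃ (ha_int.mono_set hsub) (hb_int.mono_set hsub)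
    (ae_restrict_of_ae_restrict_of_subset hsub hb_pos) <| by
      filter_upwards [ae_restrict_of_ae_restrict_of_subset hsub hineq,
        ae_restrict_mem measurableSet_Ioc] with t ht htmem
      simpa only [intervalIntegral.integral_of_le htmem.1.le, integral_Ioc_eq_integral_Ioo]
        using ht t₁ ⟨ht₁, htmem.1⟩
  rw [← hAsub ht₁ h₁₂.le, ← hBsub ht₁ h₁₂.le, ← hAsub ht₁ (h₁₂.trans h₂₃).le,
    ← hBsub ht₁ (h₁₂.trans h₂₃).le] at key
  rw [hinv _ ht₁, hinv _ ht₂, hinv _ ht₃, div_le_div_iff₀ (sub_pos.2 hyz) (sub_pos.2 hxy)]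
  linarith
end

section
/- Let R > 0 and let g : (0,R] → ℝ be continuous and monotone increasing. Suppose that for almost every r₀ ∈ (0,R), g is differentiable at r₀ and for every r₁ ∈ (r₀, R] one has g(r₁) − g(r₀) ≤ g'(r₀) · (r₁ − r₀). Then g is concave on (0,R]. -/
open MeasureTheory Set

/-- A monotone function whose derivative is almost everywhere at least `m` grows at least
linearly with slope `m`. -/
theorem MonotoneOn.mul_sub_le_sub_of_le_deriv_ae {f : ℝ → ℝ} {a b m : ℝ} (hab : a ≤ b)
    (hf : MonotoneOn f (Icc a b))
    (hm : ∀ᵐ r ∂(volume.restrict (Ioo a b)), m ≤ deriv f r) :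
    m * (b - a) ≤ f b - f a := by
  have hf' : MonotoneOn f (uIcc a b) := by rwa [uIcc_of_le hab]
  have hmem := hf'.intervalIntegral_deriv_mem_uIcc
  rw [uIcc_of_le (sub_nonneg.2 (hf (left_mem_Icc.2 hab) (right_mem_Icc.2 hab) hab))] at hmem
  have hint : ∫ _ in a..b, m ≤ ∫ r in a..b, deriv f r := by
    refine intervalIntegral.integral_mono_ae_restrict hab intervalIntegrable_const
      hf'.intervalIntegrable_deriv ?_
    rwa [← restrict_Ioo_eq_restrict_Icc]
  rw [intervalIntegral.integral_const, smul_eq_mul] at hint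
  linarith [hmem.2]

/-- If `g` is continuous and monotone increasing on `(0,R]`, and for a.e. `r₀ ∈ (0,R)`
`g` is differentiable at `r₀` with `g(r₁) − g(r₀) ≤ g'(r₀)(r₁ − r₀)` for all
`r₁ ∈ (r₀, R]`, then `g` is concave on `(0,R]`. -/
theorem stmt_1 (R : ℝ) (hR : 0 < R) (g : ℝ → ℝ)
    (hg_cont : ContinuousOn g (Ioc 0 R))
    (hg_mono : MonotoneOn g (Ioc 0 R))
    (hderiv : ∀ᵐ r₀ ∂(volume.restrict (Ioo (0 : ℝ) R)),
      DifferentiableAt ℝ g r₀ ∧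
        ∀ r₁ ∈ Ioc r₀ R, g r₁ - g r₀ ≤ deriv g r₀ * (r₁ - r₀)) :
    ConcaveOn ℝ (Ioc 0 R) g := by
  refine concaveOn_of_slope_anti_adjacent (convex_Ioc 0 R) fun {x y z} hx hz hxy hyz => ?_
  suffices hchord : (g z - g x) / (z - x) * (y - x) ≤ g y - g x by
    have hxz : 0 < z - x := by linarith
    rw [div_mul_eq_mul_div, div_le_iff₀ hxz] at hchord
    rw [div_le_div_iff₀ (by linarith) (by linarith)]
    linarith
  set m := (g z - g x) / (z - x)
  have hmz : m * (z - x) = g z - g x := div_mul_cancel₀ _ (by linarith)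
  by_contra! hlt
  have hsub : Icc x y ⊆ Ioc 0 R := fun t ht => ⟨hx.1.trans_le ht.1, by linarith [ht.2, hz.2]⟩
  have hcont : ContinuousOn (fun t => g t - g x - m * (t - x)) (Icc x y) :=
    ((hg_cont.mono hsub).sub continuousOn_const).sub (by fun_prop)
  have hcompact : IsCompact (Icc x y ∩ (fun t => g t - g x - m * (t - x)) ⁻¹' Ici 0) :=
    isCompact_Icc.of_isClosed_subset
      (hcont.preimage_isClosed_of_isClosed isClosed_Icc isClosed_Ici) inter_subset_left
  obtain ⟨s, ⟨hs, hs0⟩, hmax⟩ := hcompact.exists_isGreatest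
    ⟨x, left_mem_Icc.2 hxy.le, by simp⟩
  simp only [mem_preimage, mem_Ici] at hs0
  have hgrow : m * (y - s) ≤ g y - g s := by
    refine (hg_mono.mono ((Icc_subset_Icc_left hs.1).trans hsub)).mul_sub_le_sub_of_le_deriv_ae
      hs.2 ?_
    have hIoo : Ioo s y ⊆ Ioo 0 R := fun t ht =>
      ⟨by linarith [ht.1, hs.1, hx.1], by linarith [ht.2, hz.2]⟩
    filter_upwards [ae_restrict_of_ae_restrict_of_subset hIoo hderiv,
      ae_restrict_mem measurableSet_Ioo] with r hr hrs
    have hrz : r < z := hrs.2.trans hyz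
    have hbelow : g r - g x - m * (r - x) < 0 := by
      by_contra! hnonneg
      exact hrs.1.not_ge (hmax ⟨⟨hs.1.trans hrs.1.le, hrs.2.le⟩, hnonneg⟩)
    have hupper := hr.2 z ⟨hrz, hz.2⟩
    refine le_of_mul_le_mul_right ?_ (sub_pos.2 hrz)
    linarith
  linarith
end

section
/- Let I : [0,∞) → ℝ be a monotone decreasing function with I(t) → 0 as t → +∞, and let H : (0,∞) → ℝ be a Lebesgue measurable function such that 0 ≤ H(t) ≤ −I'(t) for almost every t ∈ (0,∞) and ∫₀^∞ H(t) dt = I(0). Then I(t) = ∫_t^∞ H(s) ds for every t ∈ [0,∞), and H(t) = −I'(t) for almost every t ∈ (0,∞). -/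
open MeasureTheory Set Filter
open scoped Topology

theorem AntitoneOn.ae_differentiableAt_of_isOpen {f : ℝ → ℝ} {s : Set ℝ} (hf : AntitoneOn f s)
    (hs : IsOpen s) : ∀ᵐ x ∂volume.restrict s, DifferentiableAt ℝ f x := by
  filter_upwards [hf.neg.ae_differentiableWithinAt hs.measurableSet,
    ae_restrict_mem hs.measurableSet] with x hx hxs
  simpa using (hx.differentiableAt (hs.mem_nhds hxs)).neg

theorem AntitoneOn.intervalIntegrable_neg_deriv {f : ℝ → ℝ} {a b : ℝ}
    (hf : AntitoneOn f (uIcc a b)) :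
    IntervalIntegrable (fun x ↦ -deriv f x) volume a b := by
  have h := hf.neg.intervalIntegrable_deriv
  rwa [deriv.fun_neg'] at h

theorem AntitoneOn.intervalIntegral_neg_deriv_le {f : ℝ → ℝ} {a b : ℝ} (hab : a ≤ b)
    (hf : AntitoneOn f (uIcc a b)) : ∫ x in a..b, -deriv f x ≤ f a - f b := by
  have h := hf.neg.intervalIntegral_deriv_mem_uIcc
  have hba : f b ≤ f a := hf left_mem_uIcc right_mem_uIcc hab
  rw [deriv.fun_neg', uIcc_of_le (by linarith)] at h
  linarith [h.2]

/-- If `I` is monotone decreasing on `[0,∞)` with `I(t) → 0` as `t → ∞`, and `H ≥ 0`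
is measurable with `H(t) ≤ −I'(t)` at a.e. point of differentiability of `I` and
`∫₀^∞ H = I(0)`, then `I(t) = ∫_t^∞ H` for all `t ≥ 0` and `H = −I'` a.e. -/
theorem stmt_5 (I H : ℝ → ℝ)
    (hI_anti : AntitoneOn I (Ici 0))
    (hI_lim : Tendsto I atTop (𝓝 0))
    (hH_meas : Measurable H)
    (hH : ∀ᵐ ta ∂(volume.restrict (Ioi (0 : ℝ))), DifferentiableAt ℝ I ta →
      0 ≤ H ta ∧ H ta ≤ -deriv I ta)
    (hH_int : IntegrableOn H (Ioi 0))
    (hHI : (∫ ta in Ioi (0 : ℝ), H ta) = I 0) :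
    (∀ ta ∈ Ici (0 : ℝ), I ta = ∫ s in Ioi ta, H s) ∧
      ∀ᵐ ta ∂(volume.restrict (Ioi (0 : ℝ))), DifferentiableAt ℝ I ta →
        H ta = -deriv I ta := by
  have hle : ∀ᵐ x ∂volume.restrict (Ioi (0 : ℝ)), H x ≤ -deriv I x := by
    filter_upwards [hH, (hI_anti.mono Ioi_subset_Ici_self).ae_differentiableAt_of_isOpen isOpen_Ioi]
      with x hx hd using (hx hd).2
  have hle' {a b : ℝ} (ha : 0 ≤ a) : H ≤ᵐ[volume.restrict (Ioc a b)] fun x ↦ -deriv I x :=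
    ae_restrict_of_ae_restrict_of_subset (fun x hx ↦ ha.trans_lt hx.1) hle
  have hanti {a b : ℝ} (ha : 0 ≤ a) (hab : a ≤ b) : AntitoneOn I (uIcc a b) := by
    rw [uIcc_of_le hab]
    exact hI_anti.mono fun x hx ↦ ha.trans hx.1
  have hHi {a : ℝ} (ha : 0 ≤ a) : IntegrableOn H (Ioi a) :=
    hH_int.mono_set (Ioi_subset_Ioi ha)
  have hHii {a b : ℝ} (ha : 0 ≤ a) (hab : a ≤ b) : IntervalIntegrable H volume a b :=
    (intervalIntegrable_iff_integrableOn_Ioc_of_le hab).2 ((hHi ha).mono_set Ioc_subset_Ioi_self)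
  have hmono {a b : ℝ} (ha : 0 ≤ a) (hab : a ≤ b) :
      ∫ x in a..b, H x ≤ ∫ x in a..b, -deriv I x := by
    simpa only [intervalIntegral.integral_of_le hab] using
      setIntegral_mono_ae_restrict (hHii ha hab).1
        (hanti ha hab).intervalIntegrable_neg_deriv.1 (hle' ha)
  have hder {a b : ℝ} (ha : 0 ≤ a) (hab : a ≤ b) : ∫ x in a..b, -deriv I x ≤ I a - I b :=
    (hanti ha hab).intervalIntegral_neg_deriv_le hab
  have htail {a : ℝ} (ha : 0 ≤ a) : ∫ x in Ioi a, H x ≤ I a := by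
    refine le_of_tendsto_of_tendsto
      (intervalIntegral_tendsto_integral_Ioi a (hHi ha) tendsto_id)
      (by simpa using hI_lim.const_sub (I a)) ?_
    filter_upwards [eventually_ge_atTop a] with b hb
    exact (hmono ha hb).trans (hder ha hb)
  have hsplit {a : ℝ} (ha : 0 ≤ a) : (∫ x in (0 : ℝ)..a, H x) + ∫ x in Ioi a, H x = I 0 :=
    hHI ▸ intervalIntegral.integral_interval_add_Ioi hH_int (hHi ha)
  refine ⟨fun t ht ↦ ?_, ?_⟩
  · have ht : 0 ≤ t := ht
    linarith [htail ht, hsplit ht, hmono le_rfl ht, hder le_rfl ht]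
  · have hIoc (n : ℕ) : ∀ᵐ x ∂volume.restrict (Ioc (0 : ℝ) n), H x = -deriv I x := by
      have hn : (0 : ℝ) ≤ n := n.cast_nonneg
      have hHn := hHii le_rfl hn
      have hDn := (hanti le_rfl hn).intervalIntegrable_neg_deriv
      have hzero : ∫ x in (0 : ℝ)..n, (-deriv I x - H x) = 0 := by
        rw [intervalIntegral.integral_sub hDn hHn]
        linarith [htail hn, hsplit hn, hmono le_rfl hn, hder le_rfl hn]
      rw [intervalIntegral.integral_eq_zero_iff_of_le_of_nonneg_ae hn
        ((hle' le_rfl).mono fun x hx ↦ sub_nonneg.2 hx) (hDn.sub hHn)] at hzero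
      exact hzero.mono fun x hx ↦ (sub_eq_zero.1 hx).symm
    have hcover : ⋃ n : ℕ, Ioc (0 : ℝ) n = Ioi 0 :=
      iUnion_Ioc_eq_Ioi_self_iff.2 fun x _ ↦ exists_nat_ge x
    rw [← hcover, ae_restrict_iUnion_iff]
    exact fun n ↦ (hIoc n).mono fun x hx _ ↦ hx
end

section
/- Let D₁ and D₂ be open subsets of ℂ, let p : D₁ → D₂ be a bijective holomorphic map, let w₀ ∈ D₁ and set z₀ := p(w₀). Then inf{ ∫_{D₂} |f(z)|² dλ(z) : f holomorphic on D₂ with f(z₀) = 1 } = |p'(w₀)|² · inf{ ∫_{D₁} |g(w)|² dλ(w) : g holomorphic on D₁ with g(w₀) = 1 }, where both infima are taken in [0,+∞]. -/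
open MeasureTheory Set
open scoped ENNReal NNReal

open Filter Topology

/-- A holomorphic injective map on an open set is open at each point. -/
theorem Set.InjOn.nhds_le_map_nhds_of_differentiableOn {U : Set ℂ} {p : ℂ → ℂ}
    (hinj : InjOn p U) (hU : IsOpen U) (hp : DifferentiableOn ℂ p U) {w : ℂ} (hw : w ∈ U) :
    𝓝 (p w) ≤ map p (𝓝 w) := by
  have hUw : U ∈ 𝓝 w := hU.mem_nhds hw
  refine (hp.analyticAt hUw).eventually_constant_or_nhds_le_map_nhds.resolve_left fun h => ?_
  have h' : ∀ᶠ x in 𝓝[≠] w, False := by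
    filter_upwards [nhdsWithin_le_nhds h, nhdsWithin_le_nhds hUw, self_mem_nhdsWithin]
      with x hx hxU hxw
    exact hxw (hinj hxU hw hx)
  exact h'.exists.elim fun _ => id

/-- The derivative of an injective holomorphic map has isolated zeros. -/
theorem Set.InjOn.eventually_deriv_ne_zero_of_differentiableOn {U : Set ℂ} {p : ℂ → ℂ}
    (hinj : InjOn p U) (hU : IsOpen U) (hp : DifferentiableOn ℂ p U) {w : ℂ} (hw : w ∈ U) :
    ∀ᶠ x in 𝓝[≠] w, deriv p x ≠ 0 := by
  have hUw : U ∈ 𝓝 w := hU.mem_nhds hw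
  refine (hp.analyticAt hUw).deriv.eventually_eq_zero_or_eventually_ne_zero.resolve_left
    fun h => ?_
  obtain ⟨r, hr, hball⟩ := Metric.eventually_nhds_iff_ball.1 (h.and hUw)
  have h' : ∀ᶠ x in 𝓝[≠] w, False := by
    filter_upwards [nhdsWithin_le_nhds (Metric.ball_mem_nhds w hr), self_mem_nhdsWithin]
      with x hx hxw
    refine hxw (hinj (hball x hx).2 hw ?_)
    exact Metric.isOpen_ball.is_const_of_deriv_eq_zero (convex_ball w r).isPreconnected
      (hp.mono fun y hy => (hball y hy).2) (fun y hy => (hball y hy).1) hx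
      (Metric.mem_ball_self hr)
  exact h'.exists.elim fun _ => id

/-- The inverse of a holomorphic bijection between open sets is holomorphic. -/
theorem Set.InvOn.differentiableOn_of_bijOn {U V : Set ℂ} {p q : ℂ → ℂ} (hU : IsOpen U)
    (hV : IsOpen V) (hp : DifferentiableOn ℂ p U) (hbij : BijOn p U V) (hinv : InvOn q p U V) :
    DifferentiableOn ℂ q V := by
  have hqV : MapsTo q V U := (hbij.symm hinv.symm).mapsTo
  have hcont : ∀ z ∈ V, ContinuousAt q z := by
    intro z hz
    have hle := hbij.injOn.nhds_le_map_nhds_of_differentiableOn hU hp (hqV hz)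
    rw [hinv.2 hz] at hle
    have hqp : Tendsto (q ∘ p) (𝓝 (q z)) (𝓝 (q z)) :=
      tendsto_id.congr' <| (hU.eventually_mem (hqV hz)).mono fun x hx => (hinv.1 hx).symm
    exact (tendsto_map'_iff.2 hqp).mono_left hle
  intro z hz
  refine (Complex.analyticAt_of_differentiable_on_punctured_nhds_of_continuousAt ?_
    (hcont z hz)).differentiableAt.differentiableWithinAt
  have hVz : V ∈ 𝓝 z := hV.mem_nhds hz
  have hq : Tendsto q (𝓝[≠] z) (𝓝[≠] (q z)) := by
    refine tendsto_nhdsWithin_iff.2 ⟨(hcont z hz).tendsto.mono_left nhdsWithin_le_nhds, ?_⟩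
    filter_upwards [nhdsWithin_le_nhds hVz, self_mem_nhdsWithin] with x hx hxz hqx
    exact hxz ((hbij.symm hinv.symm).injOn hx hz hqx)
  filter_upwards [nhdsWithin_le_nhds hVz,
    hq.eventually (hbij.injOn.eventually_deriv_ne_zero_of_differentiableOn hU hp (hqV hz))] with x hx hne
  exact (HasDerivAt.of_local_left_inverse (hcont x hx)
    (hp.differentiableAt (hU.mem_nhds (hqV hx))).hasDerivAt hne
    (by filter_upwards [hV.mem_nhds hx] with y hy using hinv.2 hy)).differentiableAt

/-- Change of variables for an injective holomorphic map. -/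
theorem lintegral_image_eq_lintegral_enorm_deriv_sq_mul {U : Set ℂ} {p : ℂ → ℂ} (hU : IsOpen U)
    (hp : DifferentiableOn ℂ p U) (hinj : InjOn p U) (F : ℂ → ℝ≥0∞) :
    ∫⁻ z in p '' U, F z = ∫⁻ w in U, (‖deriv p w‖₊ : ℝ≥0∞) ^ 2 * F (p w) := by
  rw [lintegral_image_eq_lintegral_abs_det_fderiv_mul volume hU.measurableSet
    (fun w hw => (((hp.differentiableAt (hU.mem_nhds hw)).hasDerivAt.hasFDerivAt).restrictScalars
      ℝ).hasFDerivWithinAt) hinj]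
  refine lintegral_congr fun w => ?_
  congr 1
  rw [← ENNReal.coe_pow, ENNReal.ofReal, ENNReal.coe_inj]
  ext
  simp [ContinuousLinearMap.det, LinearMap.det_restrictScalars, Algebra.norm_complex_eq,
    Complex.normSq_eq_norm_sq]

/-- The minimal `L²` norm (squared) of a holomorphic function with value `1` at a given point
does not decrease too much under pullback by an injective holomorphic map. -/
theorem enorm_deriv_sq_mul_sInf_le {U V : Set ℂ} {p : ℂ → ℂ} (hU : IsOpen U)
    (hp : DifferentiableOn ℂ p U) (hbij : BijOn p U V) (w₀ : ℂ) :
    (‖deriv p w₀‖₊ : ℝ≥0∞) ^ 2 *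
        sInf {v : ℝ≥0∞ | ∃ g : ℂ → ℂ, DifferentiableOn ℂ g U ∧ g w₀ = 1 ∧
          v = ∫⁻ w in U, (‖g w‖₊ : ℝ≥0∞) ^ 2} ≤
      sInf {v : ℝ≥0∞ | ∃ f : ℂ → ℂ, DifferentiableOn ℂ f V ∧ f (p w₀) = 1 ∧
        v = ∫⁻ z in V, (‖f z‖₊ : ℝ≥0∞) ^ 2} := by
  by_cases hc : deriv p w₀ = 0
  · simp [hc]
  refine le_sInf ?_
  rintro _ ⟨f, hf, hf1, rfl⟩
  set g : ℂ → ℂ := fun w => (deriv p w₀)⁻¹ * (deriv p w * f (p w)) with hg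
  have hgU : DifferentiableOn ℂ g U :=
    ((hp.deriv hU).mul (hf.comp hp hbij.mapsTo)).const_mul _
  have hg1 : g w₀ = 1 := by simp [hg, hf1, hc]
  calc _ ≤ (‖deriv p w₀‖₊ : ℝ≥0∞) ^ 2 * ∫⁻ w in U, (‖g w‖₊ : ℝ≥0∞) ^ 2 := by
        gcongr
        exact sInf_le ⟨g, hgU, hg1, rfl⟩
    _ = ∫⁻ w in U, (‖deriv p w₀‖₊ : ℝ≥0∞) ^ 2 * (‖g w‖₊ : ℝ≥0∞) ^ 2 :=
        (lintegral_const_mul' _ _ (by finiteness)).symm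
    _ = ∫⁻ w in U, (‖deriv p w‖₊ : ℝ≥0∞) ^ 2 * (‖f (p w)‖₊ : ℝ≥0∞) ^ 2 := by
        refine lintegral_congr fun w => ?_
        rw [← mul_pow, ← mul_pow, ← ENNReal.coe_mul, ← ENNReal.coe_mul, ← nnnorm_mul, ← nnnorm_mul,
          hg, mul_inv_cancel_left₀ hc]
    _ = ∫⁻ z in V, (‖f z‖₊ : ℝ≥0∞) ^ 2 := by
        rw [← hbij.image_eq,
          lintegral_image_eq_lintegral_enorm_deriv_sq_mul hU hp hbij.injOn]

/-- Conformal transformation rule for the (reciprocal) Bergman kernel: if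
`p : D₁ → D₂` is a bijective holomorphic map with `p(w₀) = z₀`, then
`inf{∫_{D₂} |f|² : f ∈ 𝒪(D₂), f(z₀) = 1} = |p'(w₀)|² · inf{∫_{D₁} |g|² : g ∈ 𝒪(D₁), g(w₀) = 1}`,
where the infima are taken in `[0,+∞]` and the integrals are with respect to Lebesgue
area measure on `ℂ`. -/
theorem stmt_6 (D₁ D₂ : Set ℂ) (hD₁ : IsOpen D₁) (hD₂ : IsOpen D₂)
    (p : ℂ → ℂ) (hp_bij : Set.BijOn p D₁ D₂) (hp_holo : DifferentiableOn ℂ p D₁)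
    (w₀ : ℂ) (hw₀ : w₀ ∈ D₁) (z₀ : ℂ) (hz₀ : z₀ = p w₀) :
    sInf {v : ℝ≥0∞ | ∃ f : ℂ → ℂ, DifferentiableOn ℂ f D₂ ∧ f z₀ = 1 ∧
        v = ∫⁻ z in D₂, (‖f z‖₊ : ℝ≥0∞) ^ 2} =
      (‖deriv p w₀‖₊ : ℝ≥0∞) ^ 2 *
        sInf {v : ℝ≥0∞ | ∃ g : ℂ → ℂ, DifferentiableOn ℂ g D₁ ∧ g w₀ = 1 ∧
          v = ∫⁻ w in D₁, (‖g w‖₊ : ℝ≥0∞) ^ 2} := by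
  subst hz₀
  have hinv := hp_bij.invOn_invFunOn
  set q := Function.invFunOn p D₁
  have hq_bij : BijOn q D₂ D₁ := hp_bij.symm hinv.symm
  have hq_holo : DifferentiableOn ℂ q D₂ := hinv.differentiableOn_of_bijOn hD₁ hD₂ hp_holo hp_bij
  have hz₀ : p w₀ ∈ D₂ := hp_bij.mapsTo hw₀
  have hqz₀ : q (p w₀) = w₀ := hinv.1 hw₀
  have hderiv : deriv p w₀ * deriv q (p w₀) = 1 := by
    have hcomp := HasDerivAt.comp (p w₀)
      (by rw [hqz₀]; exact (hp_holo.differentiableAt (hD₁.mem_nhds hw₀)).hasDerivAt)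
      (hq_holo.differentiableAt (hD₂.mem_nhds hz₀)).hasDerivAt
    refine hcomp.unique ((hasDerivAt_id (p w₀)).congr_of_eventuallyEq ?_)
    filter_upwards [hD₂.mem_nhds hz₀] with z hz using hinv.2 hz
  refine le_antisymm ?_ (enorm_deriv_sq_mul_sInf_le hD₁ hp_holo hp_bij w₀)
  have hle := enorm_deriv_sq_mul_sInf_le hD₂ hq_holo hq_bij (p w₀)
  rw [hqz₀] at hle
  refine le_trans (le_of_eq ?_) (mul_le_mul_right hle ((‖deriv p w₀‖₊ : ℝ≥0∞) ^ 2))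
  rw [← mul_assoc, ← mul_pow, ← ENNReal.coe_mul, ← nnnorm_mul, hderiv]
  simp
end

section
/- Let D₁ and D₂ be open subsets of ℂ, let p : D₁ → D₂ be a bijective holomorphic map, let w₀ ∈ D₁ and set z₀ := p(w₀). Let ψ : D₂ → [−∞,0) be upper semicontinuous, and let t ≥ 0 be such that ψ(z₀) < −t. Then inf{ liminf_{B→0⁺} (1/B) ∫_{{z ∈ D₂ : −t−B < ψ(z) < −t}} |f(z)|² dλ(z) : f holomorphic on {z ∈ D₂ : ψ(z) < −t} with f(z₀) = 1 } = |p'(w₀)|² · inf{ liminf_{B→0⁺} (1/B) ∫_{{w ∈ D₁ : −t−B < ψ(p(w)) < −t}} |g(w)|² dλ(w) : g holomorphic on {w ∈ D₁ : ψ(p(w)) < −t} with g(w₀) = 1 }, where both infima are taken in [0,+∞]. -/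
open MeasureTheory Set Filter
open scoped ENNReal NNReal Topology

/-- If `p` is injective and holomorphic on an open set, it maps neighbourhoods to
neighbourhoods. -/
lemma nhds_le_map_nhds_of_injOn {D : Set ℂ} (hD : IsOpen D) {p : ℂ → ℂ}
    (hp : DifferentiableOn ℂ p D) (hinj : InjOn p D) {w : ℂ} (hw : w ∈ D) :
    𝓝 (p w) ≤ map p (𝓝 w) := by
  have hmem := hD.mem_nhds hw
  refine (hp.analyticAt hmem).eventually_constant_or_nhds_le_map_nhds.resolve_left fun h => ?_
  have h' : ∀ᶠ z in 𝓝[≠] w, False := by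
    filter_upwards [nhdsWithin_le_nhds h, nhdsWithin_le_nhds hmem, self_mem_nhdsWithin]
      with z hz hzD hne
    exact hne (hinj hzD hw hz)
  exact h'.exists.elim fun _ => id

/-- A left inverse of an injective holomorphic map is continuous on the image. -/
lemma continuousAt_leftInvOn_of_injOn {D : Set ℂ} (hD : IsOpen D) {p q : ℂ → ℂ}
    (hp : DifferentiableOn ℂ p D) (hq : LeftInvOn q p D) {w : ℂ} (hw : w ∈ D) :
    ContinuousAt q (p w) := by
  have hle := nhds_le_map_nhds_of_injOn hD hp hq.injOn hw
  rw [ContinuousAt, hq hw]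
  refine (Filter.map_mono hle).trans ?_
  rw [Filter.map_map]
  have h : q ∘ p =ᶠ[𝓝 w] id := by
    filter_upwards [hD.mem_nhds hw] with z hz using hq hz
  rw [Filter.map_congr h, Filter.map_id]

lemma eventually_rightInverse_of_injOn {D : Set ℂ} (hD : IsOpen D) {p q : ℂ → ℂ}
    (hp : DifferentiableOn ℂ p D) (hq : LeftInvOn q p D) {w : ℂ} (hw : w ∈ D) :
    ∀ᶠ z in 𝓝 (p w), q z ∈ D ∧ p (q z) = z := by
  refine nhds_le_map_nhds_of_injOn hD hp hq.injOn hw (Filter.eventually_map.2 ?_)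
  filter_upwards [hD.mem_nhds hw] with z hz
  simp [hq hz, hz]

lemma differentiableAt_leftInvOn_of_deriv_ne_zero {D : Set ℂ} (hD : IsOpen D) {p q : ℂ → ℂ}
    (hp : DifferentiableOn ℂ p D) (hq : LeftInvOn q p D) {w : ℂ} (hw : w ∈ D)
    (hd : deriv p w ≠ 0) : DifferentiableAt ℂ q (p w) := by
  have h := (hp.differentiableAt (hD.mem_nhds hw)).hasDerivAt
  refine (HasDerivAt.of_local_left_inverse (continuousAt_leftInvOn_of_injOn hD hp hq hw)
    (f := p) (f' := deriv p w) (by rwa [hq hw]) hd ?_).differentiableAt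
  exact (eventually_rightInverse_of_injOn hD hp hq hw).mono fun z hz => hz.2

/-- The inverse of an injective holomorphic map is holomorphic. -/
lemma differentiableAt_leftInvOn {D : Set ℂ} (hD : IsOpen D) {p q : ℂ → ℂ}
    (hp : DifferentiableOn ℂ p D) (hq : LeftInvOn q p D) {w : ℂ} (hw : w ∈ D) :
    DifferentiableAt ℂ q (p w) := by
  have hmem := hD.mem_nhds hw
  have hcont := continuousAt_leftInvOn_of_injOn hD hp hq hw
  have hright := eventually_rightInverse_of_injOn hD hp hq hw
  refine (Complex.analyticAt_of_differentiable_on_punctured_nhds_of_continuousAt ?_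
    hcont).differentiableAt
  rcases (hp.analyticAt hmem).deriv.eventually_eq_zero_or_eventually_ne_zero with h | h
  · exfalso
    obtain ⟨r, hr, hball⟩ := Metric.mem_nhds_iff.1 (Filter.inter_mem h hmem)
    have hconst : ∀ᶠ z in 𝓝[≠] w, False := by
      filter_upwards [nhdsWithin_le_nhds (Metric.ball_mem_nhds w hr), self_mem_nhdsWithin]
        with z hz hne
      refine hne (hq.injOn (hball hz).2 hw ?_)
      exact Metric.isOpen_ball.is_const_of_deriv_eq_zero
        (convex_ball w r).isPreconnected (hp.mono fun x hx => (hball hx).2)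
        (fun x hx => (hball hx).1) hz (Metric.mem_ball_self hr)
    exact hconst.exists.elim fun _ => id
  · have hq' : Tendsto q (𝓝[≠] (p w)) (𝓝[≠] w) := by
      refine tendsto_nhdsWithin_iff.2 ⟨?_, ?_⟩
      · simpa [ContinuousAt, hq hw] using! hcont.tendsto.mono_left nhdsWithin_le_nhds
      · filter_upwards [nhdsWithin_le_nhds hright, self_mem_nhdsWithin] with z hz hne hqz
        exact hne (by rw [← hz.2, hqz]; rfl)
    filter_upwards [hq'.eventually h, nhdsWithin_le_nhds hright] with z hz hzr
    have := differentiableAt_leftInvOn_of_deriv_ne_zero hD hp hq hzr.1 hz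
    rwa [hzr.2] at this

/-- The derivative of an injective holomorphic map does not vanish. -/
lemma deriv_ne_zero_of_leftInvOn {D : Set ℂ} (hD : IsOpen D) {p q : ℂ → ℂ}
    (hp : DifferentiableOn ℂ p D) (hq : LeftInvOn q p D) {w : ℂ} (hw : w ∈ D) :
    deriv p w ≠ 0 := by
  intro h0
  have h := (hp.differentiableAt (hD.mem_nhds hw)).hasDerivAt
  rw [h0] at h
  refine not_differentiableAt_of_local_left_inverse_hasDerivAt_zero (f := p) (g := q)
    (a := p w) (by rwa [hq hw]) ?_ (differentiableAt_leftInvOn hD hp hq hw)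
  exact (eventually_rightInverse_of_injOn hD hp hq hw).mono fun z hz => hz.2

/-- Change of variables for an injective holomorphic map. -/
lemma lintegral_image_holomorphic {s : Set ℂ} (hs : MeasurableSet s) {p : ℂ → ℂ}
    (hp : ∀ w ∈ s, DifferentiableAt ℂ p w) (hinj : InjOn p s) (F : ℂ → ℝ≥0∞) :
    ∫⁻ z in p '' s, F z = ∫⁻ w in s, (‖deriv p w‖₊ : ℝ≥0∞) ^ 2 * F (p w) := by
  rw [lintegral_image_eq_lintegral_abs_det_fderiv_mul volume hs
    (fun w hw => ((hp w hw).hasDerivAt.hasFDerivAt.restrictScalars ℝ).hasFDerivWithinAt) hinj]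
  refine lintegral_congr fun w => ?_
  congr 1
  simp [ContinuousLinearMap.det, LinearMap.det_restrictScalars, Algebra.norm_complex_eq,
    Complex.normSq_eq_norm_sq, ENNReal.ofReal_pow, ofReal_norm, enorm_eq_nnnorm]

/-- A set cut out of an open set by bounds on a semicontinuous function is measurable. -/
lemma measurableSet_sublevel_shell {D : Set ℂ} (hD : IsOpen D) {φ : ℂ → EReal}
    (hφ : UpperSemicontinuousOn φ D) (a b : EReal) :
    MeasurableSet {w | w ∈ D ∧ a < φ w ∧ φ w < b} := by
  have h := (upperSemicontinuousOn_iff_restrict.2 hφ).measurable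
  have h2 := hD.measurableSet.subtype_image (h (measurableSet_Ioo (a := a) (b := b)))
  convert h2 using 1
  ext w
  simp only [mem_image, mem_preimage, mem_Ioo, domRestrict_apply, mem_ofPred_eq, Subtype.exists,
    exists_and_left, exists_prop, exists_eq_right_right]
  tauto

/-- Conformal transformation rule for the boundary-type (Ohsawa–Saitoh–Hardy)
minimal integral: if `p : D₁ → D₂` is a bijective holomorphic map with
`p(w₀) = z₀`, `ψ : D₂ → [−∞,0)` is upper semicontinuous and `ψ(z₀) < −t`, then the
infimum over holomorphic `f` on `{ψ < −t}` with `f(z₀) = 1` of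
`liminf_{B→0⁺} (1/B) ∫_{{−t−B < ψ < −t}} |f|²` equals `|p'(w₀)|²` times the
corresponding infimum on `D₁` for the pulled-back weight `ψ ∘ p`. -/
theorem stmt_7 (D₁ D₂ : Set ℂ) (hD₁ : IsOpen D₁) (hD₂ : IsOpen D₂)
    (p : ℂ → ℂ) (hp_bij : Set.BijOn p D₁ D₂) (hp_holo : DifferentiableOn ℂ p D₁)
    (w₀ : ℂ) (hw₀ : w₀ ∈ D₁) (z₀ : ℂ) (hz₀ : z₀ = p w₀)
    (ψ : ℂ → EReal) (hψ_usc : UpperSemicontinuousOn ψ D₂)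
    (hψ_neg : ∀ z ∈ D₂, ψ z < 0)
    (t : ℝ) (ht : 0 ≤ t) (hψz₀ : ψ z₀ < ((-t : ℝ) : EReal)) :
    sInf {v : ℝ≥0∞ | ∃ f : ℂ → ℂ,
        DifferentiableOn ℂ f {z | z ∈ D₂ ∧ ψ z < ((-t : ℝ) : EReal)} ∧ f z₀ = 1 ∧
        v = Filter.liminf (fun B : ℝ =>
          (∫⁻ z in {z | z ∈ D₂ ∧ ((-t - B : ℝ) : EReal) < ψ z ∧
              ψ z < ((-t : ℝ) : EReal)}, (‖f z‖₊ : ℝ≥0∞) ^ 2) / ENNReal.ofReal B)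
          (𝓝[>] (0 : ℝ))} =
      (‖deriv p w₀‖₊ : ℝ≥0∞) ^ 2 *
        sInf {v : ℝ≥0∞ | ∃ g : ℂ → ℂ,
          DifferentiableOn ℂ g {w | w ∈ D₁ ∧ ψ (p w) < ((-t : ℝ) : EReal)} ∧
          g w₀ = 1 ∧
          v = Filter.liminf (fun B : ℝ =>
            (∫⁻ w in {w | w ∈ D₁ ∧ ((-t - B : ℝ) : EReal) < ψ (p w) ∧
                ψ (p w) < ((-t : ℝ) : EReal)}, (‖g w‖₊ : ℝ≥0∞) ^ 2) /
              ENNReal.ofReal B) (𝓝[>] (0 : ℝ))} := by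
  obtain ⟨q, hq⟩ : ∃ q, LeftInvOn q p D₁ := ⟨_, hp_bij.injOn.leftInvOn_invFunOn⟩
  have hd : ∀ w ∈ D₁, deriv p w ≠ 0 := fun w hw => deriv_ne_zero_of_leftInvOn hD₁ hp_holo hq hw
  have hd₀ := hd w₀ hw₀
  have hc₀ : (‖deriv p w₀‖₊ : ℝ≥0∞) ^ 2 ≠ 0 := by simpa using hd₀
  have hc : (‖deriv p w₀‖₊ : ℝ≥0∞) ^ 2 ≠ ∞ := by simp
  have key : ∀ f g : ℂ → ℂ,
      (∀ w ∈ D₁, ψ (p w) < ((-t : ℝ) : EReal) → deriv p w * f (p w) = deriv p w₀ * g w) →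
      Filter.liminf (fun B : ℝ =>
          (∫⁻ z in {z | z ∈ D₂ ∧ ((-t - B : ℝ) : EReal) < ψ z ∧
              ψ z < ((-t : ℝ) : EReal)}, (‖f z‖₊ : ℝ≥0∞) ^ 2) / ENNReal.ofReal B)
          (𝓝[>] (0 : ℝ)) =
        (‖deriv p w₀‖₊ : ℝ≥0∞) ^ 2 * Filter.liminf (fun B : ℝ =>
            (∫⁻ w in {w | w ∈ D₁ ∧ ((-t - B : ℝ) : EReal) < ψ (p w) ∧
                ψ (p w) < ((-t : ℝ) : EReal)}, (‖g w‖₊ : ℝ≥0∞) ^ 2) /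
              ENNReal.ofReal B) (𝓝[>] (0 : ℝ)) := by
    intro f g hfg
    rw [← ENNReal.liminf_const_mul_of_ne_zero_of_ne_top hc₀ hc]
    congr 1
    funext B
    have hs := measurableSet_sublevel_shell hD₁
      (hψ_usc.comp hp_holo.continuousOn hp_bij.mapsTo) ((-t - B : ℝ) : EReal) ((-t : ℝ) : EReal)
    simp only [Function.comp_apply] at hs
    have himage : {z | z ∈ D₂ ∧ ((-t - B : ℝ) : EReal) < ψ z ∧ ψ z < ((-t : ℝ) : EReal)} =
        p '' {w | w ∈ D₁ ∧ ((-t - B : ℝ) : EReal) < ψ (p w) ∧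
          ψ (p w) < ((-t : ℝ) : EReal)} := by
      ext z
      constructor
      · rintro ⟨hz, hz'⟩
        obtain ⟨w, hw, rfl⟩ := hp_bij.surjOn hz
        exact ⟨w, ⟨hw, hz'⟩, rfl⟩
      · rintro ⟨w, ⟨hw, hw'⟩, rfl⟩
        exact ⟨hp_bij.mapsTo hw, hw'⟩
    rw [himage, lintegral_image_holomorphic hs
      (fun w hw => hp_holo.differentiableAt (hD₁.mem_nhds hw.1))
      (hp_bij.injOn.mono fun w hw => hw.1), ← mul_div_assoc,
      ← lintegral_const_mul' _ _ hc]
    congr 1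
    refine setLIntegral_congr_fun hs fun w hw => ?_
    simp only [← mul_pow, ← ENNReal.coe_mul, ← nnnorm_mul, hfg w hw.1 hw.2.2]
  have hmaps : MapsTo p {w | w ∈ D₁ ∧ ψ (p w) < ((-t : ℝ) : EReal)}
      {z | z ∈ D₂ ∧ ψ z < ((-t : ℝ) : EReal)} := fun w hw => ⟨hp_bij.mapsTo hw.1, hw.2⟩
  have hsub : {w | w ∈ D₁ ∧ ψ (p w) < ((-t : ℝ) : EReal)} ⊆ D₁ := fun w hw => hw.1
  have hmaps' : MapsTo q {z | z ∈ D₂ ∧ ψ z < ((-t : ℝ) : EReal)}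
      {w | w ∈ D₁ ∧ ψ (p w) < ((-t : ℝ) : EReal)} := by
    rintro z ⟨hz, hz'⟩
    obtain ⟨w, hw, rfl⟩ := hp_bij.surjOn hz
    rw [hq hw]
    exact ⟨hw, hz'⟩
  have hq_holo : DifferentiableOn ℂ q {z | z ∈ D₂ ∧ ψ z < ((-t : ℝ) : EReal)} := by
    rintro z ⟨hz, -⟩
    obtain ⟨w, hw, rfl⟩ := hp_bij.surjOn hz
    exact (differentiableAt_leftInvOn hD₁ hp_holo hq hw).differentiableWithinAt
  have hdp := (hp_holo.deriv hD₁).mono hsub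
  have hmul : ∀ S : Set ℝ≥0∞, (‖deriv p w₀‖₊ : ℝ≥0∞) ^ 2 * sInf S =
      ⨅ v : S, (‖deriv p w₀‖₊ : ℝ≥0∞) ^ 2 * v := fun S => by
    rw [sInf_eq_iInf', ENNReal.mul_iInf_of_ne hc₀ hc]
  rw [hmul]
  subst hz₀
  apply le_antisymm
  · refine le_iInf ?_
    rintro ⟨v, g, hg, hg₀, rfl⟩
    refine sInf_le ⟨fun z => deriv p w₀ * g (q z) / deriv p (q z), ?_, ?_, ?_⟩
    · exact ((hg.comp hq_holo hmaps').const_mul _).div (hdp.comp hq_holo hmaps')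
        fun z hz => hd _ (hmaps' hz).1
    · simp [hq hw₀, hg₀, hd₀]
    · refine (key _ g fun w hw _ => ?_).symm
      rw [hq hw, mul_div_cancel₀ _ (hd w hw)]
  · refine le_sInf ?_
    rintro v ⟨f, hf, hf₀, rfl⟩
    refine iInf_le_of_le ⟨_, fun w => deriv p w * f (p w) / deriv p w₀, ?_, ?_, rfl⟩ ?_
    · exact (hdp.mul (hf.comp (hp_holo.mono hsub) hmaps)).div_const _
    · simp [hf₀, hd₀]
    · refine (key f _ fun w _ _ => ?_).ge
      rw [mul_div_cancel₀ _ hd₀]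
end

section
/- Let k : [0,∞) → (0,∞) be a function such that t ↦ k(t)e^{−t} is monotone decreasing on [0,∞), and let u : [0,∞) → [0,∞) be monotone decreasing with 1/k(t) ≤ −u'(t) for almost every t ∈ (0,∞). Then 1/k(0) ≤ u(0). -/
open MeasureTheory Set Filter
open scoped Topology

/-- If an integrable `g` is a.e. bounded by the negative derivative of a decreasing function `u`
wherever `u` is differentiable, then its integral is at most the total decrease of `u`. -/
theorem AntitoneOn.intervalIntegral_le_sub_of_ae_le_neg_deriv {u g : ℝ → ℝ} {a b : ℝ}
    (hab : a ≤ b) (hu : AntitoneOn u (Icc a b)) (hg : IntervalIntegrable g volume a b)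
    (h : ∀ᵐ t ∂(volume.restrict (Ioo a b)), DifferentiableAt ℝ u t → g t ≤ -deriv u t) :
    ∫ t in a..b, g t ≤ u a - u b := by
  have hmono : MonotoneOn (-u) (uIcc a b) := by
    rw [uIcc_of_le hab]
    exact hu.neg
  have hab' : (-u) a ≤ (-u) b := hmono left_mem_uIcc right_mem_uIcc hab
  have hmem := hmono.intervalIntegral_deriv_mem_uIcc
  rw [uIcc_of_le (sub_nonneg.2 hab')] at hmem
  have hle : ∫ t in a..b, g t ≤ ∫ t in a..b, deriv (-u) t := by
    refine intervalIntegral.integral_mono_ae_restrict hab hg hmono.intervalIntegrable_deriv ?_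
    rw [← restrict_Ioo_eq_restrict_Icc]
    filter_upwards [h, ae_restrict_of_ae hmono.ae_differentiableWithinAt_of_mem,
      ae_restrict_mem measurableSet_Ioo] with t ht hdiff htmem
    rw [uIcc_of_le hab] at hdiff
    have hd : DifferentiableAt ℝ (-u) t :=
      (hdiff (Ioo_subset_Icc_self htmem)).differentiableAt (Icc_mem_nhds htmem.1 htmem.2)
    rw [deriv.neg]
    exact ht (by simpa using hd.neg)
  have hsub : (-u) b - (-u) a = u a - u b := by simp only [Pi.neg_apply]; ring
  exact hle.trans (hmem.2.trans_eq hsub)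

/-- If `k : [0,∞) → (0,∞)` is such that `k(t)e^{−t}` is monotone decreasing, and
`u : [0,∞) → [0,∞)` is monotone decreasing with `1/k(t) ≤ −u'(t)` at a.e. point of
differentiability of `u`, then `1/k(0) ≤ u(0)`. -/
theorem stmt_8 (k u : ℝ → ℝ)
    (hk_pos : ∀ t ∈ Ici (0 : ℝ), 0 < k t)
    (hk_anti : AntitoneOn (fun t => k t * Real.exp (-t)) (Ici 0))
    (hu_anti : AntitoneOn u (Ici 0))
    (hu_nonneg : ∀ t ∈ Ici (0 : ℝ), 0 ≤ u t)
    (hderiv : ∀ᵐ t ∂(volume.restrict (Ioi (0 : ℝ))), DifferentiableAt ℝ u t →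
      1 / k t ≤ -deriv u t) :
    1 / k 0 ≤ u 0 := by
  have hk : ∀ t ∈ Ioi (0 : ℝ), Real.exp (-t) / k 0 ≤ 1 / k t := by
    intro t ht
    have h0t : (0 : ℝ) ≤ t := le_of_lt ht
    have h := hk_anti self_mem_Ici h0t h0t
    simp only [neg_zero, Real.exp_zero, mul_one] at h
    rw [div_le_div_iff₀ (hk_pos 0 self_mem_Ici) (hk_pos t h0t)]
    linarith
  have hbound : ∀ b : ℝ, 0 ≤ b → (1 - Real.exp (-b)) / k 0 ≤ u 0 := by
    intro b hb
    have hint : ∫ t in (0 : ℝ)..b, Real.exp (-t) / k 0 = (1 - Real.exp (-b)) / k 0 := by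
      simp
    have hle := AntitoneOn.intervalIntegral_le_sub_of_ae_le_neg_deriv
      (g := fun t => Real.exp (-t) / k 0) hb (hu_anti.mono Icc_subset_Ici_self)
      ((by fun_prop : Continuous fun t => Real.exp (-t) / k 0).intervalIntegrable 0 b) (by
        filter_upwards [ae_restrict_of_ae_restrict_of_subset Ioo_subset_Ioi_self hderiv,
          ae_restrict_mem measurableSet_Ioo] with t ht htmem hd
        exact (hk t htmem.1).trans (ht hd))
    linarith [hu_nonneg b hb]
  have hlim : Tendsto (fun b => (1 - Real.exp (-b)) / k 0) atTop (𝓝 (1 / k 0)) := by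
    simpa using (Real.tendsto_exp_neg_atTop_nhds_zero.const_sub 1).div_const (k 0)
  exact le_of_tendsto hlim ((eventually_ge_atTop 0).mono hbound)
end

section
/- Let r > 0 and let B(0,r) = {z ∈ ℂ : |z| < r} be the open disk of radius r centered at the origin. Then inf{ liminf_{B→0⁺} (1/B) ∫_{{z : r e^{−B/2} < |z| < r}} |f(z)|² dλ(z) : f holomorphic on B(0,r) with f(0) = 1 } = π r². -/
open MeasureTheory Set Filter
open scoped ENNReal NNReal Topology

/-- Integration in polar coordinates on `ℂ`, as an iterated lower integral over circles. -/
lemma lintegral_eq_lintegral_circleMap {h : ℂ → ℝ≥0∞} (hh : Measurable h) :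
    ∫⁻ z, h z = ∫⁻ ρ in Ioi (0 : ℝ), ENNReal.ofReal ρ *
      ∫⁻ θ in Ioo (-Real.pi) Real.pi, h (circleMap 0 ρ θ) := by
  have hsymm : ∀ p : ℝ × ℝ, Complex.polarCoord.symm p = circleMap 0 p.1 p.2 := by
    intro p
    simp [circleMap, Complex.exp_mul_I]
  have hmeas : Measurable fun p : ℝ × ℝ => h (circleMap 0 p.1 p.2) :=
    hh.comp (by unfold circleMap; fun_prop)
  rw [← Complex.lintegral_comp_polarCoord_symm]
  simp_rw [hsymm, smul_eq_mul]
  change ∫⁻ p in Ioi (0 : ℝ) ×ˢ Ioo (-Real.pi) Real.pi, _ ∂(volume.prod volume) = _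
  rw [setLIntegral_prod _ (by fun_prop)]
  exact lintegral_congr fun ρ => lintegral_const_mul (ENNReal.ofReal ρ)
    (f := fun θ => h (circleMap 0 ρ θ)) (hmeas.comp measurable_prodMk_left)

/-- The sub-mean value inequality for `‖f‖ ^ 2` on a circle inside the domain of holomorphy. -/
lemma enorm_sq_le_lintegral_circleMap {f : ℂ → ℂ} {r ρ : ℝ}
    (hf : DifferentiableOn ℂ f (Metric.ball 0 r)) (hρ : 0 < ρ) (hρr : ρ < r) :
    ∫⁻ _ in Ioo (-Real.pi) Real.pi, ‖f 0‖ₑ ^ 2 ≤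
      ∫⁻ θ in Ioo (-Real.pi) Real.pi, ‖f (circleMap 0 ρ θ)‖ₑ ^ 2 := by
  have hd : DiffContOnCl ℂ (fun z => f z ^ 2) (Metric.ball 0 |ρ|) := by
    refine ((hf.pow 2).mono ?_).diffContOnCl
    rw [abs_of_pos hρ, closure_ball _ hρ.ne']
    exact Metric.closedBall_subset_ball hρr
  have hmean : ∫ θ in Ioo (-Real.pi) Real.pi, f (circleMap 0 ρ θ) ^ 2 =
      ((2 * Real.pi : ℝ) : ℂ) * f 0 ^ 2 := by
    have h := hd.circleAverage
    rw [Real.circleAverage_eq_integral_add (-Real.pi),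
      intervalIntegral.integral_comp_add_right (fun θ => f (circleMap 0 ρ θ) ^ 2),
      show 2 * Real.pi + -Real.pi = Real.pi by ring, zero_add,
      intervalIntegral.integral_of_le (by linarith [Real.pi_pos]),
      integral_Ioc_eq_integral_Ioo] at h
    rw [← h, Complex.real_smul, ← mul_assoc, ← Complex.ofReal_mul,
      mul_inv_cancel₀ (by positivity), Complex.ofReal_one, one_mul]
  have hle := enorm_integral_le_lintegral_enorm (μ := volume.restrict (Ioo (-Real.pi) Real.pi))
    fun θ => f (circleMap 0 ρ θ) ^ 2
  rw [hmean, enorm_mul, enorm_pow] at hle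
  simp_rw [enorm_pow] at hle
  refine le_trans (le_of_eq ?_) hle
  rw [setLIntegral_const, Real.volume_Ioo, mul_comm, ← ofReal_norm ((2 * Real.pi : ℝ) : ℂ), Complex.norm_real,
    Real.norm_of_nonneg (by positivity)]
  congr 2
  ring

/-- On a centred annulus, `∫ ‖f‖ ^ 2` is at least its value for the constant function `f 0`. -/
lemma enorm_sq_mul_volume_annulus_le {f : ℂ → ℂ} {a r : ℝ}
    (hf : DifferentiableOn ℂ f (Metric.ball 0 r)) :
    ‖f 0‖ₑ ^ 2 * volume {z : ℂ | a < ‖z‖ ∧ ‖z‖ < r} ≤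
      ∫⁻ z in {z : ℂ | a < ‖z‖ ∧ ‖z‖ < r}, ‖f z‖ₑ ^ 2 := by
  classical
  set A : Set ℂ := {z : ℂ | a < ‖z‖ ∧ ‖z‖ < r} with hA
  have hAm : MeasurableSet A :=
    (measurableSet_lt measurable_const measurable_norm).inter
      (measurableSet_lt measurable_norm measurable_const)
  have hfA : ContinuousOn (fun z => ‖f z‖ₑ ^ 2) A := by
    have hc : ContinuousOn f A := hf.continuousOn.mono fun z hz => by simpa using hz.2
    exact (ENNReal.continuous_pow 2).comp_continuousOn (continuous_enorm.comp_continuousOn hc)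
  have hm : Measurable (A.indicator fun z => ‖f z‖ₑ ^ 2) := by
    rw [← piecewise_eq_indicator]
    exact hfA.measurable_piecewise continuousOn_const hAm
  rw [← setLIntegral_const, ← lintegral_indicator hAm, ← lintegral_indicator hAm,
    lintegral_eq_lintegral_circleMap (measurable_const.indicator hAm),
    lintegral_eq_lintegral_circleMap hm]
  refine setLIntegral_mono' measurableSet_Ioi fun ρ (hρ : 0 < ρ) => ?_
  gcongr ENNReal.ofReal ρ * ?_
  have hmem : ∀ θ, circleMap 0 ρ θ ∈ A ↔ a < ρ ∧ ρ < r := by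
    intro θ
    simp [hA, abs_of_pos hρ]
  by_cases h : a < ρ ∧ ρ < r
  · simp only [indicator_of_mem ((hmem _).2 h)]
    exact enorm_sq_le_lintegral_circleMap hf hρ h.2
  · simp only [indicator_of_notMem (mt (hmem _).1 h), le_refl]

lemma Complex.volume_annulus {a r : ℝ} (ha : 0 ≤ a) (har : a < r) :
    volume {z : ℂ | a < ‖z‖ ∧ ‖z‖ < r} = ENNReal.ofReal (Real.pi * (r ^ 2 - a ^ 2)) := by
  have hset : {z : ℂ | a < ‖z‖ ∧ ‖z‖ < r} = Metric.ball 0 r \ Metric.closedBall 0 a := by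
    ext z
    simp [and_comm]
  have hpi : (NNReal.pi : ℝ≥0∞) = ENNReal.ofReal Real.pi := by
    rw [ENNReal.ofReal, ← NNReal.coe_real_pi, Real.toNNReal_coe]
  rw [hset, measure_sdiff (Metric.closedBall_subset_ball har)
      measurableSet_closedBall.nullMeasurableSet measure_closedBall_lt_top.ne,
    Complex.volume_ball, Complex.volume_closedBall, hpi,
    ← ENNReal.ofReal_pow (ha.trans har.le), ← ENNReal.ofReal_pow ha,
    ← ENNReal.ofReal_mul (by positivity), ← ENNReal.ofReal_mul (by positivity),
    ← ENNReal.ofReal_sub _ (by positivity)]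
  congr 1
  ring

lemma tendsto_volume_annulus_div {r : ℝ} (hr : 0 < r) :
    Tendsto (fun B : ℝ => volume {z : ℂ | r * Real.exp (-B / 2) < ‖z‖ ∧ ‖z‖ < r} /
      ENNReal.ofReal B) (𝓝[>] 0) (𝓝 (ENNReal.ofReal (Real.pi * r ^ 2))) := by
  have hderiv : HasDerivAt (fun B : ℝ => -(Real.pi * r ^ 2 * Real.exp (-B)))
      (Real.pi * r ^ 2) 0 := by
    have h := (((hasDerivAt_neg (0 : ℝ)).exp).const_mul (Real.pi * r ^ 2)).neg
    simpa [Pi.neg_def] using h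
  refine (ENNReal.tendsto_ofReal hderiv.tendsto_slope_zero_right).congr' ?_
  filter_upwards [self_mem_nhdsWithin] with B (hB : 0 < B)
  have hlt : r * Real.exp (-B / 2) < r :=
    mul_lt_of_lt_one_right hr (Real.exp_lt_one_iff.2 (by linarith))
  rw [Complex.volume_annulus (by positivity) hlt, ← ENNReal.ofReal_div_of_pos hB, mul_pow,
    ← Real.exp_nat_mul, show ((2 : ℕ) : ℝ) * (-B / 2) = -B by push_cast; ring]
  congr 1
  simp only [zero_add, neg_zero, Real.exp_zero, smul_eq_mul]
  field_simp
  ring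

/-- The Ohsawa–Saitoh–Hardy minimal integral on the disk of radius `r`: the infimum
over holomorphic `f` on `B(0,r)` with `f(0) = 1` of
`liminf_{B→0⁺} (1/B) ∫_{{r e^{−B/2} < |z| < r}} |f|² dλ` equals `π r²`. -/
theorem stmt_9 (r : ℝ) (hr : 0 < r) :
    sInf {v : ℝ≥0∞ | ∃ f : ℂ → ℂ,
        DifferentiableOn ℂ f (Metric.ball 0 r) ∧ f 0 = 1 ∧
        v = Filter.liminf (fun B : ℝ =>
          (∫⁻ z in {z : ℂ | r * Real.exp (-B / 2) < ‖z‖ ∧ ‖z‖ < r},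
            (‖f z‖₊ : ℝ≥0∞) ^ 2) / ENNReal.ofReal B) (𝓝[>] (0 : ℝ))} =
      ENNReal.ofReal (Real.pi * r ^ 2) := by
  apply le_antisymm
  · refine sInf_le ⟨fun _ => 1, differentiableOn_const _, rfl, ?_⟩
    simpa using (tendsto_volume_annulus_div hr).liminf_eq.symm
  · refine le_sInf ?_
    rintro v ⟨f, hf, hf0, rfl⟩
    rw [← (tendsto_volume_annulus_div hr).liminf_eq]
    refine liminf_le_liminf (Eventually.of_forall fun B => ENNReal.div_le_div_right ?_ _)
    simpa [hf0, enorm_eq_nnnorm] using enorm_sq_mul_volume_annulus_le (a := r * Real.exp (-B / 2)) hf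
end

section
/- Let D ⊆ ℂ be open and let p : B(0,1) → D be a bijective holomorphic map from the open unit disk B(0,1) = {w ∈ ℂ : |w| < 1} onto D with p(0) = z₀. For t ≥ 0 set D_t := p({w : |w| < e^{−t/2}}). Then for every t ≥ 0, inf{ ∫_{D_t} |f(z)|² dλ(z) : f holomorphic on D_t with f(z₀) = 1 } = π |p'(0)|² e^{−t}. In particular, e^t times this infimum is constant in t. -/
open MeasureTheory Set
open scoped ENNReal NNReal
open Filter Metric Topology Function

namespace Complex

section InjectiveHolomorphic

variable {f : ℂ → ℂ} {U : Set ℂ}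

lemma not_eventually_const_of_injOn (hU : IsOpen U) (hinj : InjOn f U) {z : ℂ} (hz : z ∈ U) :
    ¬ ∀ᶠ w in 𝓝 z, f w = f z := by
  intro h
  have h1 : ∀ᶠ w in 𝓝 z, w = z := by
    filter_upwards [h, hU.mem_nhds hz] with w hw hwU using hinj hwU hz hw
  obtain ⟨w, hw, hne⟩ := ((h1.filter_mono nhdsWithin_le_nhds).and
    (self_mem_nhdsWithin : ({z}ᶜ : Set ℂ) ∈ 𝓝[≠] z)).exists
  exact hne hw

/-- An injective holomorphic function on an open set is open there. -/
lemma nhds_le_map_of_injOn (hU : IsOpen U) (hf : DifferentiableOn ℂ f U) (hinj : InjOn f U)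
    {z : ℂ} (hz : z ∈ U) : 𝓝 (f z) ≤ map f (𝓝 z) :=
  (hf.analyticAt (hU.mem_nhds hz)).eventually_constant_or_nhds_le_map_nhds.resolve_left
    (not_eventually_const_of_injOn hU hinj hz)

lemma continuousAt_invFunOn (hU : IsOpen U) (hf : DifferentiableOn ℂ f U) (hinj : InjOn f U)
    {z : ℂ} (hz : z ∈ U) : ContinuousAt (invFunOn f U) (f z) := by
  rw [ContinuousAt, hinj.leftInvOn_invFunOn hz]
  refine (tendsto_map'_iff.2 ?_).mono_left (nhds_le_map_of_injOn hU hf hinj hz)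
  refine tendsto_id.congr' ?_
  filter_upwards [hU.mem_nhds hz] with w hw using (hinj.leftInvOn_invFunOn hw).symm

lemma image_mem_nhds_of_injOn (hU : IsOpen U) (hf : DifferentiableOn ℂ f U) (hinj : InjOn f U)
    {z : ℂ} (hz : z ∈ U) {s : Set ℂ} (hs : s ∈ 𝓝 z) : f '' s ∈ 𝓝 (f z) :=
  nhds_le_map_of_injOn hU hf hinj hz (image_mem_map hs)

lemma eventually_deriv_ne_zero_of_injOn (hU : IsOpen U) (hf : DifferentiableOn ℂ f U)
    (hinj : InjOn f U) {z : ℂ} (hz : z ∈ U) : ∀ᶠ w in 𝓝[≠] z, deriv f w ≠ 0 := by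
  have han := (hf.analyticAt (hU.mem_nhds hz)).deriv
  refine han.eventually_eq_zero_or_eventually_ne_zero.resolve_left fun h ↦
    not_eventually_const_of_injOn hU hinj hz ?_
  obtain ⟨ε, hε, hball⟩ := Metric.eventually_nhds_iff_ball.1 (h.and (hU.mem_nhds hz))
  filter_upwards [ball_mem_nhds z hε] with w hw
  exact isOpen_ball.is_const_of_deriv_eq_zero (convex_ball z ε).isPreconnected
    (hf.mono fun v hv ↦ (hball v hv).2) (fun v hv ↦ (hball v hv).1) hw (mem_ball_self hε)

/-- The inverse of an injective holomorphic function is holomorphic. -/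
lemma differentiableAt_invFunOn (hU : IsOpen U) (hf : DifferentiableOn ℂ f U) (hinj : InjOn f U)
    {z : ℂ} (hz : z ∈ U) : DifferentiableAt ℂ (invFunOn f U) (f z) := by
  refine (analyticAt_of_differentiable_on_punctured_nhds_of_continuousAt ?_
    (continuousAt_invFunOn hU hf hinj hz)).differentiableAt
  have h1 := (eventually_nhdsWithin_iff.1 (eventually_deriv_ne_zero_of_injOn hU hf hinj hz)).and
    (hU.mem_nhds hz)
  rw [eventually_nhdsWithin_iff]
  filter_upwards [image_mem_nhds_of_injOn hU hf hinj hz h1]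
  rintro _ ⟨w, ⟨hw, hwU⟩, rfl⟩ hne
  have hwz : w ≠ z := fun h ↦ hne (by simp [h])
  have hg := hinj.leftInvOn_invFunOn hwU
  refine (HasDerivAt.of_local_left_inverse (f := f) (f' := deriv f w)
    (continuousAt_invFunOn hU hf hinj hwU) ?_ (hw hwz) ?_).differentiableAt
  · rw [hg]
    exact (hf.differentiableAt (hU.mem_nhds hwU)).hasDerivAt
  · filter_upwards [image_mem_nhds_of_injOn hU hf hinj hwU (hU.mem_nhds hwU)] with y hy
    exact invFunOn_eq hy

/-- The derivative of an injective holomorphic function on an open set does not vanish. -/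
lemma deriv_ne_zero_of_injOn (hU : IsOpen U) (hf : DifferentiableOn ℂ f U) (hinj : InjOn f U)
    {z : ℂ} (hz : z ∈ U) : deriv f z ≠ 0 := by
  intro h0
  have h1 := (differentiableAt_invFunOn hU hf hinj hz).hasDerivAt.comp z
    (hf.differentiableAt (hU.mem_nhds hz)).hasDerivAt
  have h2 : HasDerivAt (invFunOn f U ∘ f) 1 z := by
    refine (hasDerivAt_id z).congr_of_eventuallyEq ?_
    filter_upwards [hU.mem_nhds hz] with w hw using hinj.leftInvOn_invFunOn hw
  simpa [h0] using h1.unique h2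

/-- Holomorphic change of variables for the square norm. -/
lemma lintegral_image_enorm_sq (hU : IsOpen U) (hf : DifferentiableOn ℂ f U) (hinj : InjOn f U)
    (g : ℂ → ℂ) :
    ∫⁻ z in f '' U, ‖g z‖ₑ ^ 2 = ∫⁻ w in U, ‖deriv f w * g (f w)‖ₑ ^ 2 := by
  rw [lintegral_image_eq_lintegral_abs_det_fderiv_mul volume hU.measurableSet
    (fun w hw ↦ ((hf.differentiableAt (hU.mem_nhds hw)).hasDerivAt.hasFDerivAt.restrictScalars
      ℝ).hasFDerivWithinAt) hinj]
  refine setLIntegral_congr_fun hU.measurableSet fun w _ ↦ ?_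
  simp only [enorm_mul, mul_pow]
  congr 1
  have : |((ContinuousLinearMap.toSpanSingleton ℂ (deriv f w)).restrictScalars ℝ).det|
      = ‖deriv f w‖ ^ 2 := by
    simp [ContinuousLinearMap.det, LinearMap.det_restrictScalars, Algebra.norm_complex_apply,
      normSq_eq_norm_sq]
  rw [this, ENNReal.ofReal_pow (norm_nonneg _), ofReal_norm]

end InjectiveHolomorphic

/-- The mean value inequality on a circle, in polar coordinates. -/
lemma enorm_mul_le_lintegral_circle {F : ℂ → ℂ} {ρ r : ℝ} (h0 : 0 < ρ) (hρ : ρ < r)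
    (hF : DifferentiableOn ℂ F (ball 0 r)) :
    ∫⁻ _ in Ioo (-Real.pi) Real.pi, ‖F 0‖ₑ ≤
      ∫⁻ θ in Ioo (-Real.pi) Real.pi, ‖F (Complex.polarCoord.symm (ρ, θ))‖ₑ := by
  have hmean : Real.circleAverage F 0 ρ = F 0 := by
    apply DiffContOnCl.circleAverage
    rw [abs_of_pos h0]
    exact (hF.mono (closedBall_subset_ball hρ)).diffContOnCl_ball subset_rfl
  have hint : ∫ θ in Ioo (-Real.pi) Real.pi, F (Complex.polarCoord.symm (ρ, θ)) =
      ((2 * Real.pi : ℝ) : ℂ) * F 0 := by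
    have hper : (fun θ ↦ F (circleMap 0 ρ θ)).Periodic (2 * Real.pi) := fun θ ↦ by
      simp [periodic_circleMap 0 ρ θ]
    have hshift := hper.intervalIntegral_add_eq 0 (-Real.pi)
    rw [zero_add, show -Real.pi + 2 * Real.pi = Real.pi by ring,
      intervalIntegral.integral_of_le (by linarith [Real.pi_pos]),
      intervalIntegral.integral_of_le (by linarith [Real.pi_pos]),
      integral_Ioc_eq_integral_Ioo (x := -Real.pi)] at hshift
    rw [← hmean, Real.circleAverage, intervalIntegral.integral_of_le Real.two_pi_pos.le, hshift,
      ← Complex.real_smul, smul_inv_smul₀ Real.two_pi_pos.ne']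
    simp [circleMap, exp_mul_I]
  calc ∫⁻ _ in Ioo (-Real.pi) Real.pi, ‖F 0‖ₑ = ‖((2 * Real.pi : ℝ) : ℂ) * F 0‖ₑ := by
        rw [setLIntegral_const, Real.volume_Ioo, enorm_mul, mul_comm,
          ← ofReal_norm ((2 * Real.pi : ℝ) : ℂ), norm_real, Real.norm_of_nonneg Real.two_pi_pos.le]
        ring_nf
    _ ≤ _ := by rw [← hint]; exact enorm_integral_le_lintegral_enorm _

/-- The area mean value inequality for a holomorphic function on a disc. -/
lemma enorm_mul_volume_le_lintegral_ball {F : ℂ → ℂ} {r : ℝ}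
    (hF : DifferentiableOn ℂ F (ball 0 r)) :
    ‖F 0‖ₑ * volume (ball (0 : ℂ) r) ≤ ∫⁻ w in ball 0 r, ‖F w‖ₑ := by
  classical
  have hmeas : ∀ G : ℂ → ℂ, ContinuousOn G (ball 0 r) →
      Measurable ((ball 0 r).indicator fun w ↦ ‖G w‖ₑ) := fun G hG ↦ by
    have : ((ball 0 r).indicator fun w ↦ ‖G w‖ₑ) = fun w ↦ ‖(ball 0 r).indicator G w‖ₑ := by
      ext w; by_cases h : w ∈ ball 0 r <;> simp [h]
    rw [this]
    refine Measurable.enorm ?_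
    rw [← piecewise_eq_indicator]
    exact hG.measurable_piecewise continuousOn_const isOpen_ball.measurableSet
  have hpolar : ∀ G : ℂ → ℂ, ContinuousOn G (ball 0 r) → ∫⁻ w in ball 0 r, ‖G w‖ₑ =
      ∫⁻ ρ in Ioi (0 : ℝ), ∫⁻ θ in Ioo (-Real.pi) Real.pi, ENNReal.ofReal ρ *
        (ball 0 r).indicator (fun w ↦ ‖G w‖ₑ) (Complex.polarCoord.symm (ρ, θ)) := fun G hG ↦ by
    rw [← lintegral_indicator isOpen_ball.measurableSet,
      ← Complex.lintegral_comp_polarCoord_symm, polarCoord_target, Measure.volume_eq_prod,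
      setLIntegral_prod]
    · simp only [smul_eq_mul]
    · refine Measurable.aemeasurable ?_
      simp only [smul_eq_mul, Complex.polarCoord_symm_apply]
      exact (ENNReal.measurable_ofReal.comp measurable_fst).mul ((hmeas G hG).comp (by fun_prop))
  rw [← setLIntegral_const, hpolar F hF.continuousOn, hpolar (fun _ ↦ F 0) continuousOn_const]
  refine setLIntegral_mono' measurableSet_Ioi fun ρ (hρ : 0 < ρ) ↦ ?_
  rw [lintegral_const_mul' _ _ ENNReal.ofReal_ne_top, lintegral_const_mul' _ _ ENNReal.ofReal_ne_top]
  gcongr 1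
  have hmem : ∀ θ : ℝ, Complex.polarCoord.symm (ρ, θ) ∈ ball (0 : ℂ) r ↔ ρ < r := fun θ ↦ by
    rw [mem_ball_zero_iff, norm_polarCoord_symm, abs_of_pos hρ]
  by_cases h : ρ < r
  · simpa only [indicator, hmem, h, if_true] using enorm_mul_le_lintegral_circle hρ h hF
  · simp only [indicator, hmem, h, if_false, le_refl]

end Complex

/-- For a simply connected domain `D` uniformized by `p : B(0,1) → D` with
`p(0) = z₀`, and `D_t = p({|w| < e^{−t/2}})`, the infimum over holomorphic `f` on
`D_t` with `f(z₀) = 1` of `∫_{D_t} |f|² dλ` equals `π |p'(0)|² e^{−t}` for every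
`t ≥ 0`; in particular `e^t` times this infimum is constant in `t`. -/
theorem stmt_11 (D : Set ℂ) (hD : IsOpen D) (p : ℂ → ℂ)
    (hp_bij : Set.BijOn p (Metric.ball 0 1) D)
    (hp_holo : DifferentiableOn ℂ p (Metric.ball 0 1))
    (z₀ : ℂ) (hz₀ : p 0 = z₀) :
    ∀ t : ℝ, 0 ≤ t →
      sInf {v : ℝ≥0∞ | ∃ f : ℂ → ℂ,
          DifferentiableOn ℂ f (p '' {w : ℂ | ‖w‖ < Real.exp (-t / 2)}) ∧
          f z₀ = 1 ∧
          v = ∫⁻ z in p '' {w : ℂ | ‖w‖ < Real.exp (-t / 2)},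
            (‖f z‖₊ : ℝ≥0∞) ^ 2} =
        ENNReal.ofReal (Real.pi * ‖deriv p 0‖ ^ 2 * Real.exp (-t)) := by
  subst hz₀
  intro t ht
  set r := Real.exp (-t / 2) with hr
  have hr0 : 0 < r := Real.exp_pos _
  have hr1 : r ≤ 1 := Real.exp_le_one_iff.2 (by linarith)
  have hset : {w : ℂ | ‖w‖ < r} = Metric.ball 0 r := by ext; simp
  have hsub : Metric.ball (0 : ℂ) r ⊆ Metric.ball 0 1 := Metric.ball_subset_ball hr1
  have h0 : (0 : ℂ) ∈ Metric.ball (0 : ℂ) r := Metric.mem_ball_self hr0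
  have hinj : InjOn p (Metric.ball 0 r) := hp_bij.injOn.mono hsub
  have hholo : DifferentiableOn ℂ p (Metric.ball 0 r) := hp_holo.mono hsub
  have hderiv : DifferentiableOn ℂ (deriv p) (Metric.ball 0 r) := hholo.deriv Metric.isOpen_ball
  have hne : ∀ w ∈ Metric.ball (0 : ℂ) r, deriv p w ≠ 0 := fun w hw ↦
    Complex.deriv_ne_zero_of_injOn Metric.isOpen_ball hholo hinj hw
  have hval : ENNReal.ofReal (Real.pi * ‖deriv p 0‖ ^ 2 * Real.exp (-t)) =
      ‖deriv p 0‖ₑ ^ 2 * volume (Metric.ball (0 : ℂ) r) := by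
    have hexp : Real.exp (-t) = r ^ 2 := by rw [hr, ← Real.exp_nat_mul]; congr 1; push_cast; ring
    rw [Complex.volume_ball, hexp, ENNReal.ofReal_mul (by positivity),
      ENNReal.ofReal_mul Real.pi_pos.le, ENNReal.ofReal_pow (norm_nonneg _), ofReal_norm,
      ENNReal.ofReal_pow hr0.le, ← NNReal.coe_real_pi, ENNReal.ofReal_coe_nnreal]
    ring
  rw [hset, hval]
  apply le_antisymm
  · refine sInf_le ⟨fun z ↦ deriv p 0 / deriv p (invFunOn p (Metric.ball 0 r) z), ?_, ?_, ?_⟩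
    · rintro _ ⟨w, hw, rfl⟩
      have hg := hinj.leftInvOn_invFunOn hw
      refine DifferentiableAt.differentiableWithinAt
        (.div (by fun_prop) ?_ (by rw [hg]; exact hne w hw))
      refine DifferentiableAt.comp (g := deriv p) _ ?_
        (Complex.differentiableAt_invFunOn Metric.isOpen_ball hholo hinj hw)
      rw [hg]
      exact hderiv.differentiableAt (Metric.isOpen_ball.mem_nhds hw)
    · simp only [hinj.leftInvOn_invFunOn h0, div_self (hne 0 h0)]
    · refine Eq.trans ?_ (Complex.lintegral_image_enorm_sq Metric.isOpen_ball hholo hinj _).symm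
      rw [← setLIntegral_const]
      refine setLIntegral_congr_fun Metric.isOpen_ball.measurableSet fun w hw ↦ ?_
      simp only [hinj.leftInvOn_invFunOn hw, mul_div_cancel₀ _ (hne w hw)]
  · refine le_sInf ?_
    rintro _ ⟨f, hf, hf1, rfl⟩
    refine le_of_le_of_eq ?_ (Complex.lintegral_image_enorm_sq Metric.isOpen_ball hholo hinj f).symm
    have hF : DifferentiableOn ℂ (fun w ↦ (deriv p w * f (p w)) ^ 2) (Metric.ball 0 r) :=
      (hderiv.mul (hf.comp hholo (mapsTo_image _ _))).pow 2
    simpa only [hf1, mul_one, enorm_pow] using Complex.enorm_mul_volume_le_lintegral_ball hF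
end
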